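/- For every integer η ≥ 1 there exist constants N, K ∈ ℕ, depending only on η, with the following property. Let V be the vertex set of a median graph of dimension at most η and let l ≥ 1 be an integer. Then one can assign to every ordered pair (x̄, x) ∈ V × V a subset C_{x̄,x} ⊆ [x̄,x] and a map p_{x̄,x} from [x̄,x] to the set of nonempty subsets of C_{x̄,x}, such that: (1) if d(x,y) = 1 and y ∈ [x̄,x], then C_{x̄,x} ∩ [x̄,y] = C_{x̄,y} and p_{x̄,x} agrees with p_{x̄,y} on [x̄,y]; (2) for every z ∈ [x̄,x] and every w ∈ p_{x̄,x}(z), d(z,w) ≤ Kl; (3) for every z ∈ [x̄,x], the cardinality of B(z, Ml) ∩ C_{x̄,x} is at most N, where M = 3η + 3 + K. -/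

import Mathlib

open scoped ENNReal

namespace MedianGraph

variable {V : Type*}

/-- The metric interval `[x,y]` in a graph with respect to the edge-path metric. -/
def itv (G : SimpleGraph V) (x y : V) : Set V :=
  {z | G.dist x z + G.dist z y = G.dist x y}

/-- A subset of the vertex set is convex if it contains every interval between
two of its points. -/
def Cvx (G : SimpleGraph V) (S : Set V) : Prop :=
  ∀ a ∈ S, ∀ b ∈ S, itv G a b ⊆ S

/-- A median graph: a connected graph in which every triple of vertices has a
unique median. -/
def IsMedianGraph (G : SimpleGraph V) : Prop :=
  G.Connected ∧ ∀ x y z : V, ∃! m : V,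
    m ∈ itv G x y ∧ m ∈ itv G y z ∧ m ∈ itv G z x

/-- A halfspace: a subset which is nonempty, proper, convex with convex complement. -/
def IsHalfspace (G : SimpleGraph V) (h : Set V) : Prop :=
  h.Nonempty ∧ hᶜ.Nonempty ∧ Cvx G h ∧ Cvx G hᶜ

/-- `Hset G x y` is the set of halfspaces containing `x` but not `y`. -/
def Hset (G : SimpleGraph V) (x y : V) : Set (Set V) :=
  {h | IsHalfspace G h ∧ x ∈ h ∧ y ∉ h}

/-- The normal distance `d_nor(x,y)`: the maximum cardinality of a chain (under
inclusion) in `Hset G x y`. -/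
noncomputable def dnor (G : SimpleGraph V) (x y : V) : ℕ :=
  sSup {n : ℕ | ∃ c : Set (Set V), c ⊆ Hset G x y ∧ IsChain (· ⊆ ·) c ∧ c.encard = n}

/-- Two halfspaces cross if all four intersections of them and their
complements are nonempty. -/
def Crosses (h k : Set V) : Prop :=
  (h ∩ k).Nonempty ∧ (h ∩ kᶜ).Nonempty ∧ (hᶜ ∩ k).Nonempty ∧ (hᶜ ∩ kᶜ).Nonempty

/-- `Hn G x₀ x n`: the halfspaces `h` in `Hset G x₀ x` such that the maximum
cardinality of a chain in `{k ∈ H(x₀,x) : k ⊆ h}` equals `n`. -/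
noncomputable def Hn (G : SimpleGraph V) (x₀ x : V) (n : ℕ) : Set (Set V) :=
  {h | h ∈ Hset G x₀ x ∧
    sSup {m : ℕ | ∃ c : Set (Set V), c ⊆ {k | k ∈ Hset G x₀ x ∧ k ⊆ h} ∧
      IsChain (· ⊆ ·) c ∧ c.encard = m} = n}

/-- `Fh G x₀ x n h = {w ∈ [x₀,x] ∩ S_nor(x₀,n) : w ∉ h}`. -/
def Fh (G : SimpleGraph V) (x₀ x : V) (n : ℕ) (h : Set V) : Set V :=
  {w | w ∈ itv G x₀ x ∧ dnor G x₀ w = n ∧ w ∉ h}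

/-- The graph has dimension at most `η` if every family of pairwise crossing
halfspaces has cardinality at most `η`. -/
def DimLE (G : SimpleGraph V) (η : ℕ) : Prop :=
  ∀ F : Set (Set V), (∀ h ∈ F, IsHalfspace G h) →
    (∀ h ∈ F, ∀ k ∈ F, h ≠ k → Crosses h k) → F.encard ≤ η

end MedianGraph

namespace NetComb

/-- Finite relative downset of `S`. -/
def Down {P : Type*} [PartialOrder P] (S X : Set P) : Prop :=
  X ⊆ S ∧ X.Finite ∧ ∀ a ∈ X, ∀ b ∈ S, b ≤ a → b ∈ X

/-- Every antichain in `X` has at most `w` elements. -/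
def Width {P : Type*} [PartialOrder P] (X : Set P) (w : ℕ) : Prop :=
  ∀ A ⊆ X, IsAntichain (· ≤ ·) A → A.encard ≤ w

lemma height_fin {α : Type*} [PartialOrder α] (hf : ∀ x : α, (Set.Iic x).Finite) :
    ∀ n : ℕ, ∀ x : α, (Set.Iic x).ncard ≤ n → Order.height x ≤ n := by
  intro n
  induction n with
  | zero =>
    intro x hx
    have : (Set.Iic x) = ∅ := (Set.ncard_eq_zero (hf x)).1 (by omega)
    exact absurd (show x ∈ Set.Iic x from le_refl x) (by simp [this])
  | succ n ih =>
    intro x hx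
    rw [Order.height_le_coe_iff]
    intro y hy
    have h1 : (Set.Iic y).ncard < (Set.Iic x).ncard :=
      Set.ncard_lt_ncard (Set.Iic_ssubset_Iic.2 hy) (hf x)
    have := ih y (by omega)
    exact lt_of_le_of_lt this (by exact_mod_cast Nat.lt_succ_self n)

lemma exists_lev {P : Type*} [PartialOrder P] (S : Set P)
    (hS : ∀ h ∈ S, (S ∩ Set.Iic h).Finite) :
    ∃ lev : P → ℕ, (∀ a ∈ S, ∀ b ∈ S, a < b → lev a < lev b) ∧
      (∀ a ∈ S, ∀ n ≤ lev a, ∃ b ∈ S, b ≤ a ∧ lev b = n) := by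
  classical
  have hf : ∀ x : S, (Set.Iic x).Finite := by
    intro x
    apply Set.Finite.of_finite_image (f := Subtype.val) _ Subtype.val_injective.injOn
    apply (hS x x.2).subset
    rintro _ ⟨y, hy, rfl⟩
    exact ⟨y.2, hy⟩
  have hh : ∀ x : S, Order.height x < ⊤ := fun x =>
    lt_of_le_of_lt (height_fin hf _ x le_rfl) (ENat.natCast_lt_top _)
  refine ⟨fun a => if h : a ∈ S then (Order.height (⟨a, h⟩ : S)).toNat else 0, ?_, ?_⟩
  · intro a ha b hb hab
    simp only [ha, hb, dif_pos]
    have := Order.height_strictMono (x := (⟨a, ha⟩ : S)) (y := ⟨b, hb⟩) hab (hh _)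
    rw [← ENat.natCast_toNat (hh ⟨a, ha⟩).ne, ← ENat.natCast_toNat (hh ⟨b, hb⟩).ne] at this
    exact_mod_cast this
  · intro a ha n hn
    simp only [ha, dif_pos] at hn
    rcases hn.lt_or_eq with h | h
    · have h2 : (n : ℕ∞) < Order.height (⟨a, ha⟩ : S) := by
        rw [← ENat.natCast_toNat (hh ⟨a, ha⟩).ne]
        exact_mod_cast h
      obtain ⟨y, hy, hyn⟩ := (Order.coe_lt_height_iff (hh _)).1 h2
      refine ⟨y, y.2, hy.le, ?_⟩
      simp [hyn]
    · exact ⟨a, ha, le_rfl, by simp [ha, h]⟩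

lemma biUnion_bound {ι P : Type*} (t : Set ι) (n c : ℕ) (ht : t.encard ≤ n) (s : ι → Set P)
    (hs : ∀ i ∈ t, (s i).encard ≤ c) : (⋃ i ∈ t, s i).encard ≤ ((n * c : ℕ) : ℕ∞) := by
  have hfin : t.Finite := Set.finite_of_encard_le_coe ht
  have h1 := hfin.toFinset.set_encard_biUnion_le s
  have h2 : ∑ i ∈ hfin.toFinset, (s i).encard ≤ ∑ i ∈ hfin.toFinset, (c : ℕ∞) :=
    Finset.sum_le_sum (fun i hi => hs i (hfin.mem_toFinset.1 hi))
  have h3 : (hfin.toFinset.card : ℕ∞) ≤ n := by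
    rw [← hfin.encard_eq_coe_toFinset_card]; exact ht
  simp only [Set.Finite.mem_toFinset] at h1
  refine h1.trans (h2.trans ?_)
  simp only [Finset.sum_const, nsmul_eq_mul]
  push_cast
  gcongr

lemma fiber_bound {P : Type*} [PartialOrder P] {S X : Set P} {w : ℕ} (lev : P → ℕ)
    (hlev : ∀ a ∈ S, ∀ b ∈ S, a < b → lev a < lev b)
    (hX : X ⊆ S) (hw : Width X w) (Q : Set ℕ) (n : ℕ) (hQ : Q.encard ≤ n) :
    {k ∈ X | lev k ∈ Q}.encard ≤ ((n * w : ℕ) : ℕ∞) := by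
  have := biUnion_bound Q n w hQ (fun i => {k ∈ X | lev k = i}) (by
    intro i _
    apply hw _ (fun k hk => hk.1)
    intro a ha b hb hab hle
    have := hlev a (hX ha.1) b (hX hb.1) (lt_of_le_of_ne hle hab)
    have h1 := ha.2
    have h2 := hb.2
    omega)
  refine le_trans (Set.encard_le_encard ?_) this
  intro k hk
  simp only [Set.mem_iUnion]
  exact ⟨lev k, hk.2, hk.1, rfl⟩

lemma lev_diff {P : Type*} [PartialOrder P] {S A B : Set P} (lev : P → ℕ)
    (hpred : ∀ a ∈ S, ∀ n ≤ lev a, ∃ b ∈ S, b ≤ a ∧ lev b = n)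
    (hA : Down S A) (h : P) (hh : h ∈ A) (b : ℕ) (hB : ∀ k ∈ B, lev k < b) (m : ℕ)
    (hm : (A \ B).encard ≤ m) : lev h + 1 ≤ b + m := by
  have hsub : Set.Icc b (lev h) ⊆ lev '' (A \ B) := by
    rintro i ⟨h1, h2⟩
    obtain ⟨k, hkS, hkh, hk⟩ := hpred h (hA.1 hh) i h2
    refine ⟨k, ⟨hA.2.2 h hh k hkS hkh, fun hkB => ?_⟩, hk⟩
    have := hB k hkB
    omega
  have h1 := (Set.encard_le_encard hsub).trans ((Set.encard_image_le _ _).trans hm)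
  have h2 : (Set.Icc b (lev h)).encard = ((lev h + 1 - b : ℕ) : ℕ∞) := by
    rw [← Nat.card_Icc, ← Set.encard_coe_eq_coe_finsetCard, Finset.coe_Icc]
  rw [h2] at h1
  have : lev h + 1 - b ≤ m := by exact_mod_cast h1
  omega

theorem comb (η : ℕ) : ∃ K : ℕ, ∀ M : ℕ, ∃ N : ℕ, ∀ (P : Type*) [PartialOrder P] (S : Set P),
    (∀ h ∈ S, (S ∩ Set.Iic h).Finite) → ∀ l : ℕ, 1 ≤ l → ∃ C : Set (Set P),
      (∀ X, Down S X → Width X η → ∃ W ∈ C, Down S W ∧ W ⊆ X ∧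
        (X \ W).encard ≤ ((K * l : ℕ) : ℕ∞)) ∧
      (∀ X, Down S X → Width X η → ∀ Z, Down S Z → Z ⊆ X →
        {W | W ∈ C ∧ Down S W ∧ W ⊆ X ∧ (W \ Z).encard ≤ ((M * l : ℕ) : ℕ∞) ∧
          (Z \ W).encard ≤ ((M * l : ℕ) : ℕ∞)}.encard ≤ N) := by
  induction η with
  | zero =>
    refine ⟨0, fun M => ⟨1, fun P _ S hS l hl => ⟨{∅}, ?_, ?_⟩⟩⟩
    · intro X hX hw
      have hX0 : X = ∅ := by
        by_contra hne
        obtain ⟨a, ha⟩ := Set.nonempty_iff_ne_empty.2 hne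
        have := hw {a} (by simpa using ha) (by simp)
        simp at this
      subst hX0
      exact ⟨∅, rfl, hX, le_rfl, by simp⟩
    · intro X hX hw Z hZ hZX
      refine (Set.encard_le_encard (t := {∅}) (fun W hW => hW.1)).trans ?_
      simp
  | succ η ih =>
    obtain ⟨K, hK⟩ := ih
    refine ⟨K + η + 1, fun M => ?_⟩
    obtain ⟨N, hN⟩ := hK M
    refine ⟨1 + ((2 * M + 1) * (η + 1)) * N, fun P _ S hS l hl => ?_⟩
    obtain ⟨lev, hlev, hpred⟩ := exists_lev S hS
    have hmono : ∀ a ∈ S, ∀ b ∈ S, a ≤ b → lev a ≤ lev b := by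
      intro a ha b hb hab
      rcases hab.lt_or_eq with h | h
      · exact (hlev a ha b hb h).le
      · rw [h]
    let T : P → Set P := fun h => {k | k ∈ S ∧ lev k ≤ lev h ∧ ¬ k ≤ h ∧ ¬ h ≤ k}
    have hTS : ∀ h, T h ⊆ S := fun h k hk => hk.1
    have hT : ∀ h, ∀ k ∈ T h, (T h ∩ Set.Iic k).Finite := fun h k hk =>
      (hS k hk.1).subset (Set.inter_subset_inter_left _ (hTS h))
    choose D hD1 hD2 using fun h => hN P (T h) (hT h) l hl
    -- restriction of downsets
    have hres : ∀ h, ∀ X, Down S X → Down (T h) (X ∩ T h) := by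
      intro h X hX
      refine ⟨Set.inter_subset_right, hX.2.1.subset Set.inter_subset_left, ?_⟩
      intro a ha b hb hba
      exact ⟨hX.2.2 a ha.1 b hb.1 hba, hb⟩
    have hresW : ∀ h, ∀ X, h ∈ X → Width X (η + 1) → Width (X ∩ T h) η := by
      intro h X hh hw A hA hanti
      have hnot : h ∉ A := fun hA' => (hA hA').2.2.2.1 le_rfl
      have h1 := hw (insert h A) (by
        intro k hk
        rcases hk with rfl | hk
        · exact hh
        · exact (hA hk).1) (by
        refine hanti.insert ?_ ?_
        · intro k hk _ hle
          exact (hA hk).2.2.2.1 hle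
        · intro k hk _ hle
          exact (hA hk).2.2.2.2 hle)
      rw [Set.encard_insert_of_notMem hnot] at h1
      push_cast at h1
      exact (ENat.add_le_add_iff_right (by simp)).1 h1
    have hjoin : ∀ h ∈ S, ∀ W, Down (T h) W → Down S ((S ∩ Set.Iic h) ∪ W) := by
      intro h hh W hW
      refine ⟨Set.union_subset Set.inter_subset_left (hW.1.trans (hTS h)),
        (hS h hh).union hW.2.1, ?_⟩
      rintro a (ha | ha) b hb hba
      · exact Or.inl ⟨hb, hba.trans ha.2⟩
      · by_cases hbh : b ≤ h
        · exact Or.inl ⟨hb, hbh⟩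
        · right
          have haT := hW.1 ha
          exact hW.2.2 a ha b ⟨hb, (hmono b hb a haT.1 hba).trans haT.2.1, hbh,
            fun hle => haT.2.2.2 (hle.trans hba)⟩ hba
    refine ⟨{∅} ∪ {W | ∃ h ∈ S, l ∣ lev h ∧ ∃ W' ∈ D h, Down (T h) W' ∧
      W = (S ∩ Set.Iic h) ∪ W'}, ?_, ?_⟩
    · intro X hX hw
      rcases X.eq_empty_or_nonempty with rfl | hne
      · exact ⟨∅, Or.inl rfl, hX, le_rfl, by simp⟩
      obtain ⟨a, haX, hamax⟩ := Set.exists_max_image X lev hX.2.1 hne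
      obtain ⟨h, hhS, hha, hhn⟩ := hpred a (hX.1 haX) (l * (lev a / l)) (Nat.mul_div_le _ _)
      have hhX : h ∈ X := hX.2.2 a haX h hhS hha
      obtain ⟨W', hW'D, hW', hW'X, hcard⟩ := hD1 h (X ∩ T h) (hres h X hX) (hresW h X hhX hw)
      refine ⟨(S ∩ Set.Iic h) ∪ W', Or.inr ⟨h, hhS, by rw [hhn]; exact dvd_mul_right _ _, W', hW'D,
        hW', rfl⟩, hjoin h hhS W' hW', ?_, ?_⟩
      · rintro k (hk | hk)
        · exact hX.2.2 h hhX k hk.1 hk.2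
        · exact (hW'X hk).1
      · have hQ : (Set.Ioc (lev h) (lev a)).encard ≤ l := by
          rw [← Finset.coe_Ioc, Set.encard_coe_eq_coe_finsetCard, Nat.card_Ioc]
          have := Nat.div_add_mod (lev a) l
          have := Nat.mod_lt (lev a) hl
          exact_mod_cast (by omega : lev a - lev h ≤ l)
        have hfib := fiber_bound lev hlev hX.1 hw _ l hQ
        have hsub : X \ ((S ∩ Set.Iic h) ∪ W') ⊆
            ((X ∩ T h) \ W') ∪ {k ∈ X | lev k ∈ Set.Ioc (lev h) (lev a)} := by
          rintro k ⟨hkX, hk⟩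
          have hk1 : ¬ k ≤ h := fun hle => hk (Or.inl ⟨hX.1 hkX, hle⟩)
          have hk2 : k ∉ W' := fun hle => hk (Or.inr hle)
          by_cases hl1 : lev k ≤ lev h
          · left
            refine ⟨⟨hkX, hX.1 hkX, hl1, hk1, fun hle => ?_⟩, hk2⟩
            have := hlev h hhS k (hX.1 hkX) (lt_of_le_not_ge hle hk1)
            omega
          · exact Or.inr ⟨hkX, by omega, hamax k hkX⟩
        refine (Set.encard_le_encard hsub).trans ((Set.encard_union_le _ _).trans
          ((add_le_add hcard hfib).trans ?_))
        norm_cast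
        apply le_of_eq
        ring
    · intro X hX hw Z hZ hZX
      obtain ⟨b, hb1, hb2⟩ : ∃ b : ℕ, (∀ k ∈ Z, lev k < b) ∧
          (b = 0 ∨ ∃ a ∈ Z, lev a + 1 = b) := by
        rcases Z.eq_empty_or_nonempty with rfl | hne
        · exact ⟨0, by simp, Or.inl rfl⟩
        · obtain ⟨a, haZ, hamax⟩ := Set.exists_max_image Z lev hZ.2.1 hne
          exact ⟨lev a + 1, fun k hk => Nat.lt_succ_of_le (hamax k hk), Or.inr ⟨a, haZ, rfl⟩⟩
      let Q : Set ℕ := {i | l ∣ i ∧ i + 1 ≤ b + M * l ∧ b ≤ i + 1 + M * l}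
      have hQ : Q.encard ≤ ((2 * M + 1 : ℕ) : ℕ∞) := by
        have hsub : Q ⊆ (fun q => l * q) ''
            ((Finset.Icc ((b + M * l - 1) / l - 2 * M) ((b + M * l - 1) / l) : Finset ℕ) : Set ℕ) := by
          rintro _ ⟨⟨q, rfl⟩, h1, h2⟩
          refine ⟨q, ?_, rfl⟩
          simp only [Finset.coe_Icc, Set.mem_Icc]
          constructor
          · have : (b + M * l - 1) / l ≤ q + 2 * M := by
              apply Nat.div_le_of_le_mul
              have : l * (q + 2 * M) = l * q + 2 * (M * l) := by ring
              omega
            omega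
          · rw [Nat.le_div_iff_mul_le hl]
            have : q * l = l * q := mul_comm _ _
            omega
        refine (Set.encard_le_encard hsub).trans ((Set.encard_image_le _ _).trans ?_)
        rw [Set.encard_coe_eq_coe_finsetCard, Nat.card_Icc]
        exact_mod_cast (by omega)
      have hfib := fiber_bound lev hlev hX.1 hw Q _ hQ
      have hbig := biUnion_bound {k ∈ X | lev k ∈ Q} _ N hfib
        (fun h => (fun W' => (S ∩ Set.Iic h) ∪ W') ''
          {W | W ∈ D h ∧ Down (T h) W ∧ W ⊆ X ∩ T h ∧
            (W \ (Z ∩ T h)).encard ≤ ((M * l : ℕ) : ℕ∞) ∧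
            ((Z ∩ T h) \ W).encard ≤ ((M * l : ℕ) : ℕ∞)})
        (by
          intro h hh
          exact (Set.encard_image_le _ _).trans (hD2 h (X ∩ T h) (hres h X hX)
            (hresW h X hh.1 hw) (Z ∩ T h) (hres h Z hZ) (Set.inter_subset_inter_left _ hZX)))
      have hsub : {W | W ∈ ({∅} ∪ {W | ∃ h ∈ S, l ∣ lev h ∧ ∃ W' ∈ D h, Down (T h) W' ∧
          W = (S ∩ Set.Iic h) ∪ W'} : Set (Set P)) ∧ Down S W ∧ W ⊆ X ∧
          (W \ Z).encard ≤ ((M * l : ℕ) : ℕ∞) ∧ (Z \ W).encard ≤ ((M * l : ℕ) : ℕ∞)} ⊆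
          {∅} ∪ ⋃ h ∈ {k ∈ X | lev k ∈ Q}, (fun W' => (S ∩ Set.Iic h) ∪ W') ''
          {W | W ∈ D h ∧ Down (T h) W ∧ W ⊆ X ∩ T h ∧
            (W \ (Z ∩ T h)).encard ≤ ((M * l : ℕ) : ℕ∞) ∧
            ((Z ∩ T h) \ W).encard ≤ ((M * l : ℕ) : ℕ∞)} := by
        rintro W ⟨hW0 | ⟨h, hhS, hdvd, W', hW'D, hW', rfl⟩, hWd, hWX, hWZ, hZW⟩
        · exact Or.inl hW0
        right
        have hhW : h ∈ (S ∩ Set.Iic h) ∪ W' := Or.inl ⟨hhS, le_rfl⟩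
        simp only [Set.mem_iUnion]
        refine ⟨h, ⟨hWX hhW, hdvd, ?_, ?_⟩, W', ⟨hW'D, hW', ?_, ?_, ?_⟩, rfl⟩
        · exact lev_diff lev hpred hWd h hhW b hb1 _ hWZ
        · rcases hb2 with hb0 | ⟨a, haZ, hab⟩
          · omega
          · have := lev_diff lev hpred hZ a haZ (lev h + 1) (B := (S ∩ Set.Iic h) ∪ W') (by
              rintro k (hk | hk)
              · exact Nat.lt_succ_of_le (hmono k hk.1 h hhS hk.2)
              · exact Nat.lt_succ_of_le (hW'.1 hk).2.1) _ hZW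
            omega
        · exact fun k hk => ⟨hWX (Or.inr hk), hW'.1 hk⟩
        · refine (Set.encard_le_encard ?_).trans hWZ
          exact fun k hk => ⟨Or.inr hk.1, fun hkZ => hk.2 ⟨hkZ, hW'.1 hk.1⟩⟩
        · refine (Set.encard_le_encard ?_).trans hZW
          refine fun k hk => ⟨hk.1.1, ?_⟩
          rintro (h1 | h1)
          · exact hk.1.2.2.2.1 h1.2
          · exact hk.2 h1
      refine (Set.encard_le_encard hsub).trans ((Set.encard_union_le _ _).trans ?_)
      rw [Set.encard_singleton]
      push_cast at hbig ⊢
      gcongr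

end NetComb

namespace MedianGraph

section
variable {V : Type*} {G : SimpleGraph V}

lemma mem_itv {x y z : V} : z ∈ itv G x y ↔ G.dist x z + G.dist z y = G.dist x y := Iff.rfl

lemma itv_symm {x y z : V} (h : z ∈ itv G x y) : z ∈ itv G y x := by
  rw [mem_itv] at *
  rw [G.dist_comm (u := y) (v := z), G.dist_comm (u := z) (v := x), G.dist_comm (u := y) (v := x)]
  omega

lemma itv_left (x y : V) : x ∈ itv G x y := by simp [mem_itv]

lemma itv_right (x y : V) : y ∈ itv G x y := by simp [mem_itv]

lemma itv_trans (hc : G.Connected) {a b x y : V} (hy : y ∈ itv G a x) (hb : b ∈ itv G a y) :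
    b ∈ itv G a x := by
  rw [mem_itv] at *
  have h1 := hc.dist_triangle (u := b) (v := y) (w := x)
  have h2 := hc.dist_triangle (u := a) (v := b) (w := x)
  omega

/-- A neighbour of `b` on a geodesic to `a`. -/
lemma exists_nbr (hc : G.Connected) {a b : V} (hab : a ≠ b) :
    ∃ c, G.dist c b = 1 ∧ c ∈ itv G a b := by
  obtain ⟨p, hp⟩ := hc.exists_walk_length_eq_dist b a
  cases p with
  | nil => exact absurd rfl hab
  | @cons _ c _ h q =>
    refine ⟨c, SimpleGraph.dist_eq_one_iff_adj.2 h.symm, ?_⟩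
    have h1 := G.dist_le q
    have h2 := hc.dist_triangle (u := a) (v := c) (w := b)
    have h3 : G.dist c b = 1 := SimpleGraph.dist_eq_one_iff_adj.2 h.symm
    rw [SimpleGraph.Walk.length_cons] at hp
    have h4 := G.dist_comm (u := a) (v := b)
    have h5 := G.dist_comm (u := a) (v := c)
    rw [mem_itv]
    omega

lemma edge_cases (hG : IsMedianGraph G) {u v : V} (huv : G.dist u v = 1) (z : V) :
    G.dist z v = G.dist z u + 1 ∨ G.dist z u = G.dist z v + 1 := by
  obtain ⟨m, ⟨h1, h2, h3⟩, -⟩ := hG.2 u v z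
  rw [mem_itv] at h1 h2 h3
  have hc := hG.1
  have e1 := G.dist_comm (u := v) (v := m)
  have e2 := G.dist_comm (u := v) (v := z)
  have e3 := G.dist_comm (u := m) (v := z)
  have e4 := G.dist_comm (u := u) (v := m)
  omega

/-- The side of `u` of the edge `uv`. -/
def side (G : SimpleGraph V) (u v : V) : Set V := {z | G.dist z v = G.dist z u + 1}

lemma mem_side {u v z : V} : z ∈ side G u v ↔ G.dist z v = G.dist z u + 1 := Iff.rfl

lemma side_compl (hG : IsMedianGraph G) {u v : V} (huv : G.dist u v = 1) :
    (side G u v)ᶜ = side G v u := by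
  ext z
  rw [Set.mem_compl_iff, mem_side, mem_side]
  have := edge_cases hG huv z
  omega

lemma side_local (hG : IsMedianGraph G) {u v : V} (huv : G.dist u v = 1) {a b c : V}
    (ha : a ∈ side G u v) (hb : b ∈ side G u v) (hac : G.dist a c = 1) (hbc : G.dist b c = 1)
    (hab : a ≠ b) : c ∈ side G u v := by
  have hc := hG.1
  by_contra hcn
  rw [mem_side] at *
  have hcc := edge_cases hG huv c
  have d : ∀ x y, G.dist x y = G.dist y x := fun x y => G.dist_comm
  have t : ∀ x y z, G.dist x z ≤ G.dist x y + G.dist y z := fun x y z => hc.dist_triangle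
  have pos : ∀ {x y}, x ≠ y → 0 < G.dist x y := fun h => hc.pos_dist_of_ne h
  have zero : ∀ {x y}, G.dist x y = 0 → x = y := fun h => hc.dist_eq_zero_iff.1 h
  have hau : G.dist a u = G.dist c v := by
    have := t c a u; have := t a c v; have := d a c; omega
  have hbu : G.dist b u = G.dist c v := by
    have := t c b u; have := t b c v; have := d b c; omega
  have hab2 : G.dist a b = 2 := by
    have h1 := t a c b
    have h2 := d c b
    have h3 := pos hab
    have h4 := edge_cases hG hbc a
    omega
  obtain ⟨m, ⟨m1, m2, m3⟩, -⟩ := hG.2 a b u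
  rw [mem_itv] at m1 m2 m3
  have := d b m; have := d m u; have := d u a; have := d m a; have := d u m
  have ham : G.dist a m = 1 := by omega
  have hbm : G.dist b m = 1 := by omega
  have hmu : G.dist m u + 1 = G.dist c v := by omega
  have hmv : G.dist m v = G.dist c v := by
    have := edge_cases hG huv m
    have := t a m v
    omega
  have hcm : c ≠ m := by
    rintro rfl
    omega
  have hcm2 : G.dist c m = 2 := by
    have h1 := t c a m
    have h2 := d c a
    have h3 := pos hcm
    have h4 := edge_cases hG ham c
    omega
  obtain ⟨q, ⟨q1, q2, q3⟩, -⟩ := hG.2 c m v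
  rw [mem_itv] at q1 q2 q3
  have := d m q; have := d q v; have := d v c; have := d q c
  have hcq : G.dist c q = 1 := by omega
  have hmq : G.dist m q = 1 := by omega
  have hqv : G.dist q v + 1 = G.dist c v := by omega
  have haq : G.dist a q = 2 := by
    have := t a c q
    have := t a q v
    omega
  have hbq : G.dist b q = 2 := by
    have := t b c q
    have := t b q v
    omega
  apply hcm
  have := d c b; have := d q b; have := d c a; have := d q a; have := d m b
  have := d q m
  apply (hG.2 a b q).unique
  · refine ⟨?_, ?_, ?_⟩ <;> rw [mem_itv] <;> omega
  · refine ⟨?_, ?_, ?_⟩ <;> rw [mem_itv] <;> omega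

lemma side_star (hG : IsMedianGraph G) {u v : V} (huv : G.dist u v = 1) {z c : V}
    (hz : z ∈ side G u v) (hcz : c ∈ itv G u z) : c ∈ side G u v := by
  rw [mem_side] at *
  rw [mem_itv] at hcz
  have h1 := edge_cases hG huv c
  have h2 := hG.1.dist_triangle (u := z) (v := c) (w := v)
  have h3 := G.dist_comm (u := u) (v := c)
  have h4 := G.dist_comm (u := z) (v := c)
  have h5 := G.dist_comm (u := z) (v := u)
  omega

lemma side_convex_aux (hG : IsMedianGraph G) {u v : V} (huv : G.dist u v = 1) :
    ∀ n : ℕ, ∀ a ∈ side G u v, G.dist u a = n → ∀ b ∈ side G u v, itv G a b ⊆ side G u v := by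
  have hc := hG.1
  have d : ∀ x y, G.dist x y = G.dist y x := fun x y => G.dist_comm
  have t : ∀ x y z, G.dist x z ≤ G.dist x y + G.dist y z := fun x y z => hc.dist_triangle
  intro n
  induction n with
  | zero =>
    intro a ha h0 b hb c hcab
    have : u = a := hc.dist_eq_zero_iff.1 h0
    subst this
    exact side_star hG huv hb hcab
  | succ n ih =>
    intro a ha hn b hb
    have hua : u ≠ a := by
      rintro rfl
      simp at hn
    obtain ⟨a', ha'1, ha'2⟩ := exists_nbr hc hua
    have ha' : a' ∈ side G u v := side_star hG huv ha ha'2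
    rw [mem_itv] at ha'2
    have IH := ih a' ha' (by omega) b hb
    have key : ∀ k : ℕ, ∀ c ∈ itv G a b, G.dist a c = k → c ∈ side G u v := by
      intro k
      induction k with
      | zero =>
        intro c _ h0
        have : a = c := hc.dist_eq_zero_iff.1 h0
        exact this ▸ ha
      | succ k ihk =>
        intro c hcab hk
        by_cases hin : c ∈ itv G a' b
        · exact IH hin
        have hac : a ≠ c := by
          rintro rfl
          simp at hk
        obtain ⟨c', hc'1, hc'2⟩ := exists_nbr hc hac
        have hc'S : c' ∈ side G u v := by
          refine ihk c' (itv_trans hc hcab hc'2) ?_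
          rw [mem_itv] at hc'2
          omega
        rw [mem_itv] at hc'2 hcab
        rw [mem_itv] at hin
        have e1 := edge_cases hG ha'1 c
        have e2 := edge_cases hG ha'1 b
        have := d c a; have := d c a'; have := d b a; have := d b a'
        have := t a' c b
        have hca' : G.dist a' c = G.dist a c + 1 := by omega
        have hba' : G.dist a b = G.dist a' b + 1 := by omega
        obtain ⟨q, ⟨q1, q2, q3⟩, -⟩ := hG.2 a' c b
        have hqS : q ∈ side G u v := IH (itv_symm q3)
        rw [mem_itv] at q1 q2 q3
        have := d q c; have := d b q; have := d q a'
        have hqc : G.dist q c = 1 := by omega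
        refine side_local hG huv hc'S hqS hc'1 hqc ?_
        rintro rfl
        have := t a c' b
        omega
    exact fun c hcab => key _ c hcab rfl

lemma side_halfspace (hG : IsMedianGraph G) {u v : V} (huv : G.dist u v = 1) :
    IsHalfspace G (side G u v) := by
  have hvu : G.dist v u = 1 := by rw [G.dist_comm]; exact huv
  refine ⟨⟨u, by simp [mem_side, huv]⟩, ?_, ?_, ?_⟩
  · rw [side_compl hG huv]
    exact ⟨v, by simp [mem_side, hvu]⟩
  · exact fun a ha => side_convex_aux hG huv _ a ha rfl
  · rw [side_compl hG huv]
    exact fun a ha => side_convex_aux hG hvu _ a ha rfl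

lemma eq_side (hG : IsMedianGraph G) {u v : V} (huv : G.dist u v = 1) {h : Set V}
    (hh : IsHalfspace G h) (hu : u ∈ h) (hv : v ∉ h) : h = side G u v := by
  ext z
  rw [mem_side]
  have h1 := edge_cases hG huv z
  have e := G.dist_comm (u := u) (v := v)
  constructor
  · intro hz
    by_contra hne
    exact hv (hh.2.2.1 z hz u hu (show v ∈ itv G z u by rw [mem_itv]; omega))
  · intro hz
    by_contra hne
    exact hh.2.2.2 z hne v hv (show u ∈ itv G z v by rw [mem_itv]; omega) hu

lemma encard_Hset (hG : IsMedianGraph G) (w : V) :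
    ∀ n : ℕ, ∀ z, G.dist w z = n → (Hset G w z).encard = n := by
  intro n
  induction n with
  | zero =>
    intro z hz
    have : w = z := hG.1.dist_eq_zero_iff.1 hz
    subst this
    have : Hset G w w = ∅ := by
      ext h
      simp [Hset]
    simp [this]
  | succ n ih =>
    intro z hz
    have hwz : w ≠ z := by
      rintro rfl
      simp at hz
    obtain ⟨z', h1, h2⟩ := exists_nbr hG.1 hwz
    have h2' := h2
    rw [mem_itv] at h2
    have hH := side_halfspace hG h1
    have hzn : z ∉ side G z' z := by simp [mem_side]
    have hz'n : z' ∈ side G z' z := by simp [mem_side, h1]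
    have heq : Hset G w z = insert (side G z' z) (Hset G w z') := by
      ext h
      constructor
      · rintro ⟨hh, hw, hzh⟩
        by_cases hz' : z' ∈ h
        · exact Or.inl (eq_side hG h1 hh hz' hzh)
        · exact Or.inr ⟨hh, hw, hz'⟩
      · rintro (rfl | ⟨hh, hw, hz'⟩)
        · refine ⟨hH, ?_, hzn⟩
          rw [mem_side]
          omega
        · exact ⟨hh, hw, fun hzh => hz' (hh.2.2.1 w hw z hzh h2')⟩
    have hnot : side G z' z ∉ Hset G w z' := fun h => h.2.2 hz'n
    rw [heq, Set.encard_insert_of_notMem hnot, ih z' (by omega)]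
    push_cast
    rfl

lemma Hset_mono {x₀ w x : V} (hw : w ∈ itv G x₀ x) : Hset G x₀ w ⊆ Hset G x₀ x :=
  fun _ hh => ⟨hh.1, hh.2.1, fun hx => hh.2.2 (hh.1.2.2.1 x₀ hh.2.1 x hx hw)⟩

lemma Hset_finite (hG : IsMedianGraph G) (x y : V) : (Hset G x y).Finite :=
  Set.finite_of_encard_eq_coe (encard_Hset hG x _ y rfl)

lemma compl_halfspace {h : Set V} (hh : IsHalfspace G h) : IsHalfspace G hᶜ :=
  ⟨hh.2.1, by rw [compl_compl]; exact hh.1, hh.2.2.2, by rw [compl_compl]; exact hh.2.2.1⟩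

lemma Hset_inj (hG : IsMedianGraph G) {x₀ w w' : V} (heq : Hset G x₀ w = Hset G x₀ w') :
    w = w' := by
  have : Hset G w w' = ∅ := by
    rw [Set.eq_empty_iff_forall_notMem]
    rintro h ⟨hh, hw, hw'⟩
    by_cases hx : x₀ ∈ h
    · have h1 : h ∈ Hset G x₀ w' := ⟨hh, hx, hw'⟩
      rw [← heq] at h1
      exact h1.2.2 hw
    · have h1 : hᶜ ∈ Hset G x₀ w := ⟨compl_halfspace hh, hx, fun h' => h' hw⟩
      rw [heq] at h1
      exact h1.2.2 hw'
  have h2 := encard_Hset hG w _ w' rfl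
  rw [this, Set.encard_empty] at h2
  exact hG.1.dist_eq_zero_iff.1 (by exact_mod_cast h2.symm)

lemma diff_le (hG : IsMedianGraph G) (x₀ w z : V) :
    (Hset G x₀ z \ Hset G x₀ w).encard ≤ G.dist w z := by
  rw [← encard_Hset hG w _ z rfl]
  apply Set.encard_le_encard
  rintro h ⟨⟨hh, hx, hz⟩, hw⟩
  exact ⟨hh, by_contra fun hn => hw ⟨hh, hx, hn⟩, hz⟩

lemma le_diff (hG : IsMedianGraph G) {x₀ w z : V} (hw : w ∈ itv G x₀ z) :
    (G.dist w z : ℕ∞) ≤ (Hset G x₀ z \ Hset G x₀ w).encard := by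
  rw [← encard_Hset hG w _ z rfl]
  apply Set.encard_le_encard
  rintro h ⟨hh, hwh, hz⟩
  refine ⟨⟨hh, by_contra fun hn => ?_, hz⟩, fun h' => h'.2.2 hwh⟩
  exact hh.2.2.2 x₀ hn z hz hw hwh

/-- A maximal halfspace separating `x₀` from `x` is adjacent to `x`. -/
lemma max_adj (hG : IsMedianGraph G) {x₀ x : V} {h : Set V} (hh : h ∈ Hset G x₀ x)
    (hmax : ∀ k ∈ Hset G x₀ x, h ⊆ k → k = h) :
    ∃ y ∈ itv G x₀ x, Hset G x₀ y = Hset G x₀ x \ {h} := by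
  have hc := hG.1
  obtain ⟨y, hy, hymin⟩ : ∃ y ∈ h, ∀ z ∈ h, G.dist x y ≤ G.dist x z := by
    have := (measure (fun z => G.dist x z)).wf.has_min h ⟨x₀, hh.2.1⟩
    obtain ⟨y, hy, hm⟩ := this
    exact ⟨y, hy, fun z hz => not_lt.1 (hm z hz)⟩
  have hgate : ∀ z ∈ h, y ∈ itv G z x := by
    intro z hz
    obtain ⟨m, ⟨m1, m2, m3⟩, -⟩ := hG.2 z x y
    have hm : m ∈ h := hh.1.2.2.1 y hy z hz m3
    have h1 := hymin m hm
    rw [mem_itv] at m2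
    have : m = y := hc.dist_eq_zero_iff.1 (by omega)
    exact this ▸ m1
  have hyx : y ≠ x := by
    rintro rfl
    exact hh.2.2 hy
  obtain ⟨x', hx'1, hx'2⟩ := exists_nbr hc hyx
  have hsub : h ⊆ side G x' x := by
    intro z hz
    have h1 := hgate z hz
    have h2 := itv_symm (itv_trans hc (itv_symm h1) (itv_symm hx'2))
    rw [mem_itv] at h2
    rw [mem_side]
    omega
  have hx'n : x' ∈ side G x' x := by simp [mem_side, hx'1]
  have heq := hmax (side G x' x) ⟨side_halfspace hG hx'1, hsub hh.2.1, by simp [mem_side]⟩ hsub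
  have hx'h : x' ∈ h := heq ▸ hx'n
  have hx'I : x' ∈ itv G x₀ x := by
    have h1 := hsub hh.2.1
    rw [mem_side] at h1
    rw [mem_itv]
    omega
  refine ⟨x', hx'I, ?_⟩
  ext k
  constructor
  · intro hk
    refine ⟨Hset_mono hx'I hk, ?_⟩
    rintro rfl
    exact hk.2.2 hx'h
  · rintro ⟨hk, hkh⟩
    refine ⟨hk.1, hk.2.1, fun hk' => hkh ?_⟩
    rw [Set.mem_singleton_iff, ← heq]
    exact eq_side hG hx'1 hk.1 hk' hk.2.2

lemma realize (hG : IsMedianGraph G) (x₀ : V) (D : Set (Set V))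
    (hD : ∀ h ∈ D, ∀ k, IsHalfspace G k → x₀ ∈ k → k ⊆ h → k ∈ D) :
    ∀ n : ℕ, ∀ x, (Hset G x₀ x).encard = n → D ⊆ Hset G x₀ x →
      ∃ w ∈ itv G x₀ x, Hset G x₀ w = D := by
  intro n
  induction n with
  | zero =>
    intro x hx hDx
    have h0 : Hset G x₀ x = ∅ := by simpa using hx
    refine ⟨x, itv_right _ _, ?_⟩
    rw [h0] at hDx ⊢
    exact (Set.subset_empty_iff.1 hDx).symm
  | succ n ih =>
    intro x hx hDx
    by_cases hall : Hset G x₀ x ⊆ D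
    · exact ⟨x, itv_right _ _, Set.Subset.antisymm hall hDx⟩
    have hne : (Hset G x₀ x \ D).Nonempty := Set.sdiff_nonempty.2 hall
    obtain ⟨h, hhm⟩ := ((Hset_finite hG x₀ x).subset Set.sdiff_subset).exists_maximal hne
    have hhH := hhm.1.1
    obtain ⟨y, hy, hyH⟩ := max_adj hG hhH (by
      intro k hk hhk
      have hkD : k ∉ D := fun hkD => hhm.1.2 (hD k hkD h hhH.1 hhH.2.1 hhk)
      exact Set.Subset.antisymm (hhm.2 ⟨hk, hkD⟩ hhk) hhk)
    have hins : insert h (Hset G x₀ y) = Hset G x₀ x := by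
      rw [hyH, Set.insert_sdiff_singleton, Set.insert_eq_of_mem hhH]
    have hcard : (Hset G x₀ y).encard = n := by
      have hnot : h ∉ Hset G x₀ y := by rw [hyH]; simp
      rw [← hins, Set.encard_insert_of_notMem hnot] at hx
      push_cast at hx
      exact ENat.add_left_injective_of_ne_top (n := 1) (by simp) hx
    obtain ⟨w, hw, hwD⟩ := ih y hcard (by
      rw [hyH]
      exact fun k hk => ⟨hDx hk, fun hkh => hhm.1.2 (hkh ▸ hk)⟩)
    exact ⟨w, itv_trans hG.1 hy hw, hwD⟩

lemma Hset_down (hG : IsMedianGraph G) (x₀ x : V) :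
    NetComb.Down {h : Set V | IsHalfspace G h ∧ x₀ ∈ h} (Hset G x₀ x) :=
  ⟨fun _ h => ⟨h.1, h.2.1⟩, Hset_finite hG x₀ x,
    fun _ ha _ hb hba => ⟨hb.1, hb.2, fun hx => ha.2.2 (hba hx)⟩⟩

lemma Hset_width {η : ℕ} (hd : DimLE G η) (x₀ x : V) : NetComb.Width (Hset G x₀ x) η := by
  intro A hA hanti
  refine hd A (fun h hh => (hA hh).1) ?_
  intro h hh k hk hne
  refine ⟨⟨x₀, (hA hh).2.1, (hA hk).2.1⟩, ?_, ?_, ⟨x, (hA hh).2.2, (hA hk).2.2⟩⟩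
  · obtain ⟨a, ha, hak⟩ := Set.not_subset.1 (hanti hh hk hne)
    exact ⟨a, ha, hak⟩
  · obtain ⟨a, ha, hak⟩ := Set.not_subset.1 (hanti hk hh hne.symm)
    exact ⟨a, hak, ha⟩

end

end MedianGraph

open MedianGraph

/-- For every `η ≥ 1` there are constants `N, K ∈ ℕ`, depending only
on `η`, such that for every median graph of dimension at most `η` and every integer
`l ≥ 1` one can assign to each ordered pair `(x̄, x)` of vertices a set
`C x̄ x ⊆ [x̄,x]` and a map `p x̄ x` from `[x̄,x]` to nonempty subsets of `C x̄ x`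
satisfying the consistency condition (1), the displacement bound (2) with constant `K·l`,
and the local cardinality bound (3) by `N` on balls of radius `(3η+3+K)·l`. -/
theorem net_construction (η : ℕ) (hη : 1 ≤ η) :
    ∃ N K : ℕ, ∀ (V : Type*) (G : SimpleGraph V), IsMedianGraph G → DimLE G η →
      ∀ l : ℕ, 1 ≤ l →
        ∃ (C : V → V → Set V) (p : V → V → V → Set V),
          (∀ xb x : V, C xb x ⊆ itv G xb x) ∧
          (∀ xb x : V, ∀ z ∈ itv G xb x, (p xb x z).Nonempty ∧ p xb x z ⊆ C xb x) ∧
          (∀ xb x y : V, G.dist x y = 1 → y ∈ itv G xb x →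
            C xb x ∩ itv G xb y = C xb y ∧ ∀ z ∈ itv G xb y, p xb x z = p xb y z) ∧
          (∀ xb x : V, ∀ z ∈ itv G xb x, ∀ w ∈ p xb x z, G.dist z w ≤ K * l) ∧
          (∀ xb x : V, ∀ z ∈ itv G xb x,
            ({w : V | G.dist z w ≤ (3 * η + 3 + K) * l} ∩ C xb x).encard ≤ N) := by
  obtain ⟨K, hK⟩ := NetComb.comb η
  obtain ⟨N, hN⟩ := hK (3 * η + 3 + K)
  refine ⟨N, K, fun V G hG hd l hl => ?_⟩
  have hfin : ∀ x₀ : V, ∀ h ∈ {h : Set V | IsHalfspace G h ∧ x₀ ∈ h},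
      ({h : Set V | IsHalfspace G h ∧ x₀ ∈ h} ∩ Set.Iic h).Finite := by
    rintro x₀ h ⟨hh, hx⟩
    obtain ⟨y, hy⟩ := hh.2.1
    exact (Hset_finite hG x₀ y).subset fun k hk => ⟨hk.1.1, hk.1.2, fun hyk => hy (hk.2 hyk)⟩
  choose D hD1 hD2 using fun x₀ : V => hN (Set V) _ (hfin x₀) l hl
  refine ⟨fun xb x => {w | w ∈ itv G xb x ∧ Hset G xb w ∈ D xb},
    fun xb _ z => {w | w ∈ itv G xb z ∧ Hset G xb w ∈ D xb ∧ G.dist z w ≤ K * l},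
    fun xb x w hw => hw.1, ?_, ?_, fun xb x z _ w hw => hw.2.2, ?_⟩
  · intro xb x z hz
    refine ⟨?_, fun w hw => ⟨itv_trans hG.1 hz hw.1, hw.2.1⟩⟩
    obtain ⟨W, hWD, hW, hWz, hcard⟩ :=
      hD1 xb (Hset G xb z) (Hset_down hG xb z) (Hset_width hd xb z)
    obtain ⟨w, hw, hwW⟩ := realize hG xb W
      (fun h hh k hk hxk hkh => hW.2.2 h hh k ⟨hk, hxk⟩ hkh) _ z
      (encard_Hset hG xb _ z rfl) hWz
    subst hwW
    refine ⟨w, hw, hWD, ?_⟩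
    have := (le_diff hG hw).trans hcard
    rw [G.dist_comm]
    exact_mod_cast this
  · intro xb x y _ hy
    refine ⟨?_, fun _ _ => rfl⟩
    ext w
    constructor
    · rintro ⟨h1, h2⟩
      exact ⟨h2, h1.2⟩
    · rintro ⟨h1, h2⟩
      exact ⟨⟨itv_trans hG.1 hy h1, h2⟩, h1⟩
  · intro xb x z hz
    have hinj : Set.InjOn (Hset G xb)
        ({w : V | G.dist z w ≤ (3 * η + 3 + K) * l} ∩
          {w | w ∈ itv G xb x ∧ Hset G xb w ∈ D xb}) :=
      fun a _ b _ hab => Hset_inj hG hab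
    rw [← hinj.encard_image]
    refine (Set.encard_le_encard ?_).trans
      (hD2 xb (Hset G xb x) (Hset_down hG xb x) (Hset_width hd xb x) (Hset G xb z)
        (Hset_down hG xb z) (Hset_mono hz))
    rintro _ ⟨w, ⟨hw1, hw2, hw3⟩, rfl⟩
    have hw1' : G.dist z w ≤ (3 * η + 3 + K) * l := hw1
    refine ⟨hw3, Hset_down hG xb w, Hset_mono hw2, ?_, ?_⟩
    · exact (diff_le hG xb z w).trans (by exact_mod_cast hw1')
    · refine (diff_le hG xb w z).trans ?_
      rw [G.dist_comm]
      exact_mod_cast hw1'
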